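/- arXiv:1807.05475 — 3 statements merged into one kernel-verified Lean document; each statement's English description precedes it below -/
import Mathlib

section
/- Let n ≥ 1 and let ⪯ be a partial order on Fin n whose Hasse diagram is a tree (a tree poset). Then the cone σ_⪯ = {x ∈ ℝ^n : x_a ≤ x_b whenever a ⪯ b} equals cone({v_{a→b} : a ⋖ b is a covering relation of ⪯}) + ℝ·e; that is, σ_⪯ is exactly the set of vectors of the form Σ_{a⋖b} λ_{a,b} v_{a→b} + μ e with all λ_{a,b} ≥ 0 and μ ∈ ℝ. -/
noncomputable section

/-- The 0/1 indicator vector of a subset `S ⊆ Fin n`, as an element of `ℝ^n`. -/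
def indVec {n : ℕ} (S : Set (Fin n)) : Fin n → ℝ := S.indicator fun _ => 1

/-- The all-ones vector `e ∈ ℝ^n`. -/
def allOnes (n : ℕ) : Fin n → ℝ := fun _ => 1

/-- The cone `σ_⪯ = {x ∈ ℝ^n : x_a ≤ x_b whenever a ⪯ b}` of a relation. -/
def sigmaCone {n : ℕ} (r : Fin n → Fin n → Prop) : Set (Fin n → ℝ) :=
  {x | ∀ a b, r a b → x a ≤ x b}

/-- `b` covers `a` in the relation `r`: `a ⋖ b`. -/
def CoversRel {n : ℕ} (r : Fin n → Fin n → Prop) (a b : Fin n) : Prop :=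
  r a b ∧ a ≠ b ∧ ∀ c, r a c → r c b → c = a ∨ c = b

/-- The Hasse diagram of a partial order on `Fin n`, as an undirected simple graph:
an edge `{a, b}` for each covering relation `a ⋖ b`. -/
def hasseGraph {n : ℕ} (r : Fin n → Fin n → Prop) : SimpleGraph (Fin n) where
  Adj a b := CoversRel r a b ∨ CoversRel r b a
  symm := ⟨fun a b h => h.symm⟩
  loopless := ⟨fun a h => by rcases h with h | h <;> exact h.2.1 rfl⟩

/-- `r` is a tree poset: a partial order whose Hasse diagram is a tree. -/
def IsTreePoset {n : ℕ} (r : Fin n → Fin n → Prop) : Prop :=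
  (∀ a, r a a) ∧ (∀ a b c, r a b → r b c → r a c) ∧ (∀ a b, r a b → r b a → a = b) ∧
    (hasseGraph r).IsTree

/-- `B(a,b)`: the vertex set of the connected component of `b` in the Hasse diagram
after deleting the edge `{a, b}`. -/
def compB {n : ℕ} (r : Fin n → Fin n → Prop) (a b : Fin n) : Set (Fin n) :=
  {x | ((hasseGraph r).deleteEdges {s(a, b)}).Reachable b x}

/-- The ray generator `v_{a→b} = e_{B(a,b)}`. -/
def rayVec {n : ℕ} (r : Fin n → Fin n → Prop) (a b : Fin n) : Fin n → ℝ :=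
  indVec (compB r a b)

/-- `cone(V)`: the set of finite nonnegative linear combinations of elements of `V`. -/
def coneOf {n : ℕ} (V : Set (Fin n → ℝ)) : Set (Fin n → ℝ) :=
  {x | ∃ (s : Finset (Fin n → ℝ)) (c : (Fin n → ℝ) → ℝ),
    ↑s ⊆ V ∧ (∀ v ∈ s, 0 ≤ c v) ∧ x = ∑ v ∈ s, c v • v}

/-- `cone(V) + ℝ·e`. -/
def coneAddLine {n : ℕ} (V : Set (Fin n → ℝ)) : Set (Fin n → ℝ) :=
  {x | ∃ y ∈ coneOf V, ∃ μ : ℝ, x = y + μ • allOnes n}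

/-- The comparability graph of a relation: an edge `{i, j}` for each pair `i ≠ j`
with `i ⪯ j` or `j ⪯ i`. -/
def compGraph {n : ℕ} (r : Fin n → Fin n → Prop) : SimpleGraph (Fin n) where
  Adj i j := i ≠ j ∧ (r i j ∨ r j i)
  symm := ⟨fun i j h => ⟨h.1.symm, h.2.symm⟩⟩
  loopless := ⟨fun i h => h.1 rfl⟩

/-- The setoid on `Fin n` induced by a preposet: `i ∼ j` iff `i ⪯ j` and `j ⪯ i`. -/
def preSetoid {n : ℕ} (r : Fin n → Fin n → Prop)
    (hrefl : ∀ a, r a a) (htrans : ∀ a b c, r a b → r b c → r a c) : Setoid (Fin n) where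
  r i j := r i j ∧ r j i
  iseqv := ⟨fun i => ⟨hrefl i, hrefl i⟩, fun h => ⟨h.2, h.1⟩,
    fun h1 h2 => ⟨htrans _ _ _ h1.1 h2.1, htrans _ _ _ h2.2 h1.2⟩⟩

/-- The class of `j` covers the class of `i` in the partial order induced on
`∼`-equivalence classes by the preposet `r`. -/
def CoversCl {n : ℕ} (r : Fin n → Fin n → Prop) (i j : Fin n) : Prop :=
  r i j ∧ ¬ r j i ∧ ∀ c, r i c → r c j → (r c i ∨ r j c)

/-- The Hasse diagram of a preposet, as an undirected simple graph on the set of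
`∼`-equivalence classes: an edge `{C, C'}` for each covering relation `C ⋖ C'`. -/
def hasseGraphQ {n : ℕ} (r : Fin n → Fin n → Prop)
    (hrefl : ∀ a, r a a) (htrans : ∀ a b c, r a b → r b c → r a c) :
    SimpleGraph (Quotient (preSetoid r hrefl htrans)) where
  Adj C D := ∃ i j, Quotient.mk _ i = C ∧ Quotient.mk _ j = D ∧
    (CoversCl r i j ∨ CoversCl r j i)
  symm := by
    refine ⟨?_⟩
    rintro C D ⟨i, j, hi, hj, h⟩
    exact ⟨j, i, hj, hi, h.symm⟩
  loopless := by
    refine ⟨?_⟩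
    rintro C ⟨i, j, hi, hj, h⟩
    have hij : r i j ∧ r j i := Quotient.exact (hi.trans hj.symm)
    rcases h with h | h
    · exact h.2.1 hij.2
    · exact h.2.1 hij.1

/-- For a Hasse-diagram edge `[i] → [j]` of a preposet, the union of the equivalence
classes lying in the connected component of `[j]` after deleting the edge `{[i], [j]}`. -/
def compBQ {n : ℕ} (r : Fin n → Fin n → Prop)
    (hrefl : ∀ a, r a a) (htrans : ∀ a b c, r a b → r b c → r a c) (i j : Fin n) :
    Set (Fin n) :=
  {x | ((hasseGraphQ r hrefl htrans).deleteEdges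
      {s(Quotient.mk (preSetoid r hrefl htrans) i, Quotient.mk (preSetoid r hrefl htrans) j)}).Reachable
      (Quotient.mk (preSetoid r hrefl htrans) j) (Quotient.mk (preSetoid r hrefl htrans) x)}

/-- `A_i`: the connected component of `a i` in the Hasse diagram after deleting
all `k` edges `{a i, b}`. -/
def compA {n k : ℕ} (r : Fin n → Fin n → Prop) (a : Fin k → Fin n) (b : Fin n) (i : Fin k) :
    Set (Fin n) :=
  {x | ((hasseGraph r).deleteEdges {e | ∃ j, e = s(a j, b)}).Reachable (a i) x}

/-- The relation `E'` from the proof of the main theorem: all covering pairs `(i,j)` of `r`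
with `j ≠ b`, the pair `(a i₀, b)`, and the pairs `(a m, a i₀)` for `m ≠ i₀`. -/
def newRel {n k : ℕ} (r : Fin n → Fin n → Prop) (a : Fin k → Fin n) (b : Fin n) (i₀ : Fin k) :
    Fin n → Fin n → Prop :=
  fun i j => (CoversRel r i j ∧ j ≠ b) ∨ (i = a i₀ ∧ j = b) ∨
    (∃ m : Fin k, m ≠ i₀ ∧ i = a m ∧ j = a i₀)

end

/-- A function monotone along covering relations is monotone. -/
theorem mono_of_covers {n : ℕ} {r : Fin n → Fin n → Prop} (hp : IsTreePoset r)
    {x : Fin n → ℝ} (hx : ∀ a b, CoversRel r a b → x a ≤ x b) :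
    x ∈ sigmaCone r := by
  classical
  obtain ⟨hrefl, htrans, hanti, -⟩ := hp
  have key : ∀ (k : ℕ) (a b : Fin n), r a b →
      (Finset.univ.filter fun c => r a c ∧ r c b).card = k → x a ≤ x b := by
    intro k
    induction k using Nat.strong_induction_on with
    | _ k ih =>
      intro a b hab hk
      by_cases hne : a = b
      · rw [hne]
      by_cases hc : CoversRel r a b
      · exact hx a b hc
      have : ∃ c, r a c ∧ r c b ∧ c ≠ a ∧ c ≠ b := by
        by_contra hcon
        push Not at hcon
        refine hc ⟨hab, hne, fun c h1 h2 => ?_⟩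
        by_cases h : c = a
        · exact Or.inl h
        · exact Or.inr (hcon c h1 h2 h)
      obtain ⟨c, hac, hcb, hca, hcb'⟩ := this
      have h1 : x a ≤ x c := by
        refine ih _ ?_ a c hac rfl
        rw [← hk]
        apply Finset.card_lt_card
        rw [Finset.ssubset_iff_of_subset]
        · refine ⟨b, by simp [hab, hrefl], ?_⟩
          simp only [Finset.mem_filter, Finset.mem_univ, true_and, not_and]
          exact fun _ h => hcb' (hanti _ _ hcb h)
        · intro d
          simp only [Finset.mem_filter, Finset.mem_univ, true_and]
          exact fun h => ⟨h.1, htrans _ _ _ h.2 hcb⟩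
      have h2 : x c ≤ x b := by
        refine ih _ ?_ c b hcb rfl
        rw [← hk]
        apply Finset.card_lt_card
        rw [Finset.ssubset_iff_of_subset]
        · refine ⟨a, by simp [hab, hrefl], ?_⟩
          simp only [Finset.mem_filter, Finset.mem_univ, true_and, not_and]
          exact fun h => absurd (hanti _ _ h hac) hca
        · intro d
          simp only [Finset.mem_filter, Finset.mem_univ, true_and]
          exact fun h => ⟨htrans _ _ _ hac h.1, h.2⟩
      exact h1.trans h2
  exact fun a b hab => key _ a b hab rfl

/-- Along its own edge, the ray vector increases by one. -/
theorem rayVec_self {n : ℕ} {r : Fin n → Fin n → Prop} (hp : IsTreePoset r)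
    {a b : Fin n} (h : CoversRel r a b) : rayVec r a b b - rayVec r a b a = 1 := by
  have hb : b ∈ compB r a b := SimpleGraph.Reachable.refl _
  have ha : a ∉ compB r a b := by
    intro hr
    have hbr := SimpleGraph.isAcyclic_iff_forall_adj_isBridge.1 hp.2.2.2.isAcyclic
      (show (hasseGraph r).Adj a b from Or.inl h)
    exact SimpleGraph.isBridge_iff.1 hbr (SimpleGraph.Reachable.symm hr)
  simp [rayVec, indVec, ha, hb]

/-- Along any other edge, the ray vector is constant. -/
theorem rayVec_other {n : ℕ} {r : Fin n → Fin n → Prop} (hp : IsTreePoset r)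
    {a b c d : Fin n} (h : CoversRel r a b) (h' : CoversRel r c d) (hne : (a, b) ≠ (c, d)) :
    rayVec r a b d - rayVec r a b c = 0 := by
  have hadj : ((hasseGraph r).deleteEdges {s(a, b)}).Adj c d := by
    rw [SimpleGraph.deleteEdges_adj]
    refine ⟨Or.inl h', ?_⟩
    simp only [Set.mem_singleton_iff, Sym2.eq_iff, not_or, not_and]
    refine ⟨fun h1 h2 => hne (by rw [h1, h2]), fun h1 h2 => ?_⟩
    subst h1 h2
    exact h.2.1 (hp.2.2.1 _ _ h.1 h'.1)
  have hiff : c ∈ compB r a b ↔ d ∈ compB r a b :=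
    ⟨fun hc => SimpleGraph.Reachable.trans hc hadj.reachable,
      fun hd => SimpleGraph.Reachable.trans hd hadj.symm.reachable⟩
  by_cases hc : c ∈ compB r a b
  · simp [rayVec, indVec, hc, hiff.1 hc]
  · simp [rayVec, indVec, hc, mt hiff.2 hc]

/-- A function constant along covering relations of a tree poset is constant. -/
theorem const_of_covers {n : ℕ} {r : Fin n → Fin n → Prop} (hp : IsTreePoset r)
    {z : Fin n → ℝ} (hz : ∀ a b, CoversRel r a b → z b - z a = 0) (i j : Fin n) :
    z i = z j := by
  obtain ⟨w⟩ := hp.2.2.2.connected.preconnected i j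
  induction w with
  | nil => rfl
  | cons h _ ih =>
    rw [← ih]
    rcases h with h | h
    · linarith [hz _ _ h]
    · linarith [hz _ _ h]

/-- For a tree poset `⪯` on `Fin n`, the cone
`σ_⪯ = {x : x_a ≤ x_b whenever a ⪯ b}` equals
`cone({v_{a→b} : a ⋖ b a covering relation}) + ℝ·e`. -/
theorem sigmaCone_eq_cone_of_treePoset (n : ℕ) (hn : 1 ≤ n)
    (r : Fin n → Fin n → Prop) (hposet : IsTreePoset r) :
    sigmaCone r = coneAddLine {v | ∃ a b, CoversRel r a b ∧ v = rayVec r a b} := by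
  classical
  apply Set.Subset.antisymm
  · intro x hx
    set P : Finset (Fin n × Fin n) := Finset.univ.filter fun p => CoversRel r p.1 p.2 with hP
    set f : Fin n × Fin n → Fin n → ℝ := fun p => rayVec r p.1 p.2 with hf
    set l : Fin n × Fin n → ℝ := fun p => x p.2 - x p.1 with hl
    set y : Fin n → ℝ := ∑ p ∈ P, l p • f p with hy
    have hPm : ∀ p, p ∈ P ↔ CoversRel r p.1 p.2 := by intro p; simp [hP]
    have hdiff : ∀ a b, CoversRel r a b → (x - y) b - (x - y) a = 0 := by
      intro a b hab
      have : y b - y a = x b - x a := by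
        simp only [hy, Finset.sum_apply, Pi.smul_apply, smul_eq_mul]
        rw [← Finset.sum_sub_distrib]
        rw [Finset.sum_eq_single (a, b)]
        · rw [← mul_sub, rayVec_self hposet hab, mul_one]
        · intro p hpP hpne
          rw [← mul_sub, rayVec_other hposet ((hPm p).1 hpP) hab hpne, mul_zero]
        · intro h
          exact absurd ((hPm (a, b)).2 hab) h
      simp only [Pi.sub_apply]
      linarith
    refine ⟨y, ⟨P.image f, fun v => ∑ p ∈ P with f p = v, l p, ?_, ?_, ?_⟩,
      (x - y) ⟨0, hn⟩, ?_⟩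
    · intro v hv
      simp only [Finset.coe_image, Set.mem_image, Finset.mem_coe] at hv
      obtain ⟨p, hpP, rfl⟩ := hv
      exact ⟨p.1, p.2, (hPm p).1 hpP, rfl⟩
    · intro v _
      refine Finset.sum_nonneg fun p hpp => ?_
      have hc := (hPm p).1 (Finset.mem_filter.1 hpp).1
      exact sub_nonneg.2 (hx _ _ hc.1)
    · rw [hy, ← Finset.sum_fiberwise_of_maps_to
        (fun p hpP => Finset.mem_image_of_mem f hpP) (fun p => l p • f p)]
      refine Finset.sum_congr rfl fun v _ => ?_
      rw [Finset.sum_smul]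
      refine Finset.sum_congr rfl fun p hpp => ?_
      rw [(Finset.mem_filter.1 hpp).2]
    · funext i
      have := const_of_covers hposet hdiff i ⟨0, hn⟩
      simp only [Pi.add_apply, Pi.smul_apply, allOnes, smul_eq_mul, mul_one]
      rw [← this]
      simp
  · rintro x ⟨y, ⟨s, c, hs, hc, rfl⟩, μ, rfl⟩
    refine mono_of_covers hposet fun a b hab => ?_
    simp only [Pi.add_apply, Pi.smul_apply, Finset.sum_apply, allOnes]
    refine add_le_add_left (Finset.sum_le_sum fun v hv => ?_) _
    refine mul_le_mul_of_nonneg_left ?_ (hc v hv)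
    obtain ⟨a', b', hab', rfl⟩ := hs hv
    by_cases hne : (a', b') = (a, b)
    · obtain ⟨rfl, rfl⟩ := Prod.mk.inj hne
      linarith [rayVec_self hposet hab']
    · linarith [rayVec_other hposet hab' hab hne]
end

section
/- Let n ≥ 1 and let ⪯ be a connected preposet on Fin n whose Hasse diagram is a tree (a tree preposet). For each Hasse-diagram edge C → C' (C, C' equivalence classes of ∼), let v_{C→C'} = e_B where B ⊆ Fin n is the union of the equivalence classes lying in the connected component of C' in the Hasse diagram after deleting the edge {C, C'}. Then σ_⪯ = {x ∈ ℝ^n : x_i ≤ x_j whenever i ⪯ j} equals cone({v_{C→C'} : C → C' an edge of the Hasse diagram}) + ℝ·e. -/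
section TreePreposetHelpers

open Classical in
theorem coneOf_add_smul {n : ℕ} {V : Set (Fin n → ℝ)} {y v : Fin n → ℝ} {t : ℝ}
    (hy : y ∈ coneOf V) (hv : v ∈ V) (ht : 0 ≤ t) : y + t • v ∈ coneOf V := by
  obtain ⟨s, c, hs, hc, rfl⟩ := hy
  refine ⟨insert v s, fun w => (if w ∈ s then c w else 0) + (if w = v then t else 0), ?_, ?_, ?_⟩
  · intro w hw
    rcases Finset.mem_insert.1 (Finset.mem_coe.1 hw) with h | h
    · exact h ▸ hv
    · exact hs h
  · intro w _
    apply add_nonneg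
    · split_ifs with h
      · exact hc w h
      · exact le_rfl
    · split_ifs
      · exact ht
      · exact le_rfl
  · simp only [add_smul, Finset.sum_add_distrib, ite_smul, zero_smul]
    congr 1
    · rw [← Finset.sum_filter]
      apply Finset.sum_congr _ (fun _ _ => rfl)
      ext w
      simp only [Finset.mem_filter, Finset.mem_insert]
      tauto
    · rw [Finset.sum_ite_eq' (insert v s) v (fun w => t • w)]
      simp

theorem coneOf_sum {n : ℕ} {V : Set (Fin n → ℝ)} {ι : Type*} (s : Finset ι)
    (t : ι → ℝ) (v : ι → Fin n → ℝ) (hv : ∀ p ∈ s, v p ∈ V) (ht : ∀ p ∈ s, 0 ≤ t p) :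
    ∑ p ∈ s, t p • v p ∈ coneOf V := by
  classical
  induction s using Finset.induction_on with
  | empty => exact ⟨∅, 0, by simp, by simp, by simp⟩
  | insert a s ha ih =>
    rw [Finset.sum_insert ha, add_comm]
    exact coneOf_add_smul (ih (fun p hp => hv p (Finset.mem_insert_of_mem hp))
      (fun p hp => ht p (Finset.mem_insert_of_mem hp)))
      (hv a (Finset.mem_insert_self _ _)) (ht a (Finset.mem_insert_self _ _))

/-- Monotonicity along covers (and equality on classes) gives monotonicity. -/
theorem mem_sigmaCone_of_covers {n : ℕ} {r : Fin n → Fin n → Prop}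
    (hrefl : ∀ a, r a a) (htrans : ∀ a b c, r a b → r b c → r a c) (f : Fin n → ℝ)
    (hcov : ∀ a b, CoversCl r a b → f a ≤ f b) (heq : ∀ a b, r a b → r b a → f a = f b) :
    f ∈ sigmaCone r := by
  classical
  have key : ∀ m : ℕ, ∀ a b, (Finset.univ.filter fun c => r a c ∧ r c b).card ≤ m →
      r a b → f a ≤ f b := by
    intro m
    induction m with
    | zero =>
      intro a b h hab
      have : a ∈ Finset.univ.filter fun c => r a c ∧ r c b := by simp [hrefl, hab]
      have := Finset.card_pos.2 ⟨a, this⟩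
      omega
    | succ m ih =>
      intro a b h hab
      by_cases hba : r b a
      · exact (heq a b hab hba).le
      by_cases hc : CoversCl r a b
      · exact hcov a b hc
      have : ∃ c, r a c ∧ r c b ∧ ¬ r c a ∧ ¬ r b c := by
        by_contra hno
        push Not at hno
        refine hc ⟨hab, hba, fun c h1 h2 => ?_⟩
        by_cases h3 : r c a
        · exact Or.inl h3
        · exact Or.inr (hno c h1 h2 h3)
      obtain ⟨c, hac, hcb, hca, hbc⟩ := this
      have h1 : (Finset.univ.filter fun d => r a d ∧ r d c).card <
          (Finset.univ.filter fun d => r a d ∧ r d b).card := by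
        apply Finset.card_lt_card
        rw [Finset.ssubset_iff_of_subset]
        · exact ⟨b, by simp [hab, hrefl], by simp [hbc]⟩
        · intro d hd
          simp only [Finset.mem_filter, Finset.mem_univ, true_and] at hd ⊢
          exact ⟨hd.1, htrans _ _ _ hd.2 hcb⟩
      have h2 : (Finset.univ.filter fun d => r c d ∧ r d b).card <
          (Finset.univ.filter fun d => r a d ∧ r d b).card := by
        apply Finset.card_lt_card
        rw [Finset.ssubset_iff_of_subset]
        · exact ⟨a, by simp [hab, hrefl], by simp [hca]⟩
        · intro d hd
          simp only [Finset.mem_filter, Finset.mem_univ, true_and] at hd ⊢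
          exact ⟨htrans _ _ _ hac hd.1, hd.2⟩
      exact (ih a c (by omega) hac).trans (ih c b (by omega) hcb)
  intro a b hab
  exact key _ a b le_rfl hab

variable {n : ℕ} {r : Fin n → Fin n → Prop}
  (hrefl : ∀ a, r a a) (htrans : ∀ a b c, r a b → r b c → r a c)

theorem qmk_eq_iff (a b : Fin n) : (Quotient.mk (preSetoid r hrefl htrans) a =
    Quotient.mk (preSetoid r hrefl htrans) b) ↔ (r a b ∧ r b a) :=
  ⟨fun h => Quotient.exact h, fun h => Quotient.sound h⟩

theorem coversCl_congr {htrans : ∀ a b c, r a b → r b c → r a c} {a b a' b' : Fin n}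
    (h : CoversCl r a b) (ha : r a a' ∧ r a' a)
    (hb : r b b' ∧ r b' b) : CoversCl r a' b' := by
  refine ⟨htrans _ _ _ ha.2 (htrans _ _ _ h.1 hb.1), fun h' => h.2.1 ?_, fun c h1 h2 => ?_⟩
  · exact htrans _ _ _ hb.1 (htrans _ _ _ h' ha.2)
  · rcases h.2.2 c (htrans _ _ _ ha.1 h1) (htrans _ _ _ h2 hb.2) with h3 | h3
    · exact Or.inl (htrans _ _ _ h3 ha.1)
    · exact Or.inr (htrans _ _ _ hb.2 h3)

theorem mem_compBQ_congr (i j : Fin n) {a b : Fin n} (h : r a b ∧ r b a) :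
    a ∈ compBQ r hrefl htrans i j ↔ b ∈ compBQ r hrefl htrans i j := by
  unfold compBQ
  rw [Set.mem_ofPred_eq, Set.mem_ofPred_eq, (qmk_eq_iff hrefl htrans a b).2 h]

theorem mem_compBQ_cover {i j a b : Fin n} (hij : CoversCl r i j) (hab : CoversCl r a b)
    (hne : ¬ ((r a i ∧ r i a) ∧ (r b j ∧ r j b))) :
    a ∈ compBQ r hrefl htrans i j ↔ b ∈ compBQ r hrefl htrans i j := by
  have hadj : ((hasseGraphQ r hrefl htrans).deleteEdges
      {s(Quotient.mk (preSetoid r hrefl htrans) i,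
        Quotient.mk (preSetoid r hrefl htrans) j)}).Adj
      (Quotient.mk (preSetoid r hrefl htrans) a) (Quotient.mk (preSetoid r hrefl htrans) b) := by
    rw [SimpleGraph.deleteEdges_adj]
    refine ⟨⟨a, b, rfl, rfl, Or.inl hab⟩, ?_⟩
    rw [Set.mem_singleton_iff, Sym2.eq_iff]
    simp only [qmk_eq_iff]
    rintro (h | ⟨h1, h2⟩)
    · exact hne h
    · exact hij.2.1 (htrans _ _ _ h1.2 (htrans _ _ _ hab.1 h2.1))
  exact ⟨fun h => SimpleGraph.Reachable.trans h hadj.reachable,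
    fun h => SimpleGraph.Reachable.trans h hadj.symm.reachable⟩

theorem right_mem_compBQ (i j : Fin n) : j ∈ compBQ r hrefl htrans i j :=
  SimpleGraph.Reachable.refl _

theorem left_notMem_compBQ (htree : (hasseGraphQ r hrefl htrans).IsTree) {i j : Fin n}
    (hij : CoversCl r i j) : i ∉ compBQ r hrefl htrans i j := by
  intro h
  have hb := SimpleGraph.isAcyclic_iff_forall_adj_isBridge.1 htree.isAcyclic
    (v := Quotient.mk (preSetoid r hrefl htrans) i)
    (w := Quotient.mk (preSetoid r hrefl htrans) j) ⟨i, j, rfl, rfl, Or.inl hij⟩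
  rw [SimpleGraph.isBridge_iff] at hb
  exact hb (SimpleGraph.Reachable.symm h)

theorem indVec_congr {S : Set (Fin n)} {a b : Fin n} (h : a ∈ S ↔ b ∈ S) :
    indVec S a = indVec S b := by
  classical
  simp only [indVec, Set.indicator_apply, h]

theorem indVec_compBQ_mem_sigmaCone {i j : Fin n} (hij : CoversCl r i j) :
    indVec (compBQ r hrefl htrans i j) ∈ sigmaCone r := by
  apply mem_sigmaCone_of_covers hrefl htrans
  · intro a b hab
    by_cases h : (r a i ∧ r i a) ∧ (r b j ∧ r j b)
    · have hb : b ∈ compBQ r hrefl htrans i j :=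
        (mem_compBQ_congr hrefl htrans i j h.2).2 (right_mem_compBQ hrefl htrans i j)
      classical
      simp only [indVec, Set.indicator_apply, hb, if_true]
      split_ifs <;> norm_num
    · exact (indVec_congr (mem_compBQ_cover hrefl htrans hij hab h)).le
  · intro a b h1 h2
    exact indVec_congr (mem_compBQ_congr hrefl htrans i j ⟨h1, h2⟩)

end TreePreposetHelpers

/-- For a connected tree preposet `⪯` on `Fin n`, the cone `σ_⪯`
equals `cone({v_{C→C'} : C → C' an edge of the Hasse diagram on classes}) + ℝ·e`. -/
theorem sigmaCone_eq_cone_of_treePreposet (n : ℕ) (hn : 1 ≤ n)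
    (r : Fin n → Fin n → Prop)
    (hrefl : ∀ a, r a a) (htrans : ∀ a b c, r a b → r b c → r a c)
    (htree : (hasseGraphQ r hrefl htrans).IsTree) :
    sigmaCone r =
      coneAddLine {v | ∃ i j, CoversCl r i j ∧ v = indVec (compBQ r hrefl htrans i j)} := by
  classical
  ext x
  constructor
  · intro hx
    have hxe : ∀ a b, (r a b ∧ r b a) → x a = x b := fun a b h =>
      le_antisymm (hx a b h.1) (hx b a h.2)
    let Q := Quotient (preSetoid r hrefl htrans)
    let q : Fin n → Q := Quotient.mk (preSetoid r hrefl htrans)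
    have : Fintype Q := Fintype.ofFinite Q
    let s : Finset (Q × Q) := Finset.univ.filter fun p => CoversCl r p.1.out p.2.out
    let t : Q × Q → ℝ := fun p => x p.2.out - x p.1.out
    let v : Q × Q → Fin n → ℝ := fun p => indVec (compBQ r hrefl htrans p.1.out p.2.out)
    have hs : ∀ p ∈ s, CoversCl r p.1.out p.2.out := fun p hp => (Finset.mem_filter.1 hp).2
    let y : Fin n → ℝ := ∑ p ∈ s, t p • v p
    have hy : y ∈ coneOf {v | ∃ i j, CoversCl r i j ∧
        v = indVec (compBQ r hrefl htrans i j)} := by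
      apply coneOf_sum
      · intro p hp
        exact ⟨_, _, hs p hp, rfl⟩
      · intro p hp
        exact sub_nonneg.2 (hx _ _ (hs p hp).1)
    have hye : ∀ a b, (r a b ∧ r b a) → y a = y b := by
      intro a b h
      simp only [y, Finset.sum_apply, Pi.smul_apply]
      refine Finset.sum_congr rfl fun p _ => ?_
      exact congrArg (t p • ·)
        (indVec_congr (mem_compBQ_congr hrefl htrans p.1.out p.2.out h))
    have hout : ∀ a, r (q a).out a ∧ r a (q a).out := fun a =>
      (qmk_eq_iff hrefl htrans _ _).1 (Quotient.out_eq (q a))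
    have hyc : ∀ a b, CoversCl r a b → x a - y a = x b - y b := by
      intro a b hab
      have hab' : CoversCl r (q a).out (q b).out :=
        coversCl_congr (htrans := htrans) hab (hout a).symm (hout b).symm
      have hd : y b - y a = x b - x a := by
        simp only [y, Finset.sum_apply, Pi.smul_apply, smul_eq_mul]
        rw [← Finset.sum_sub_distrib, Finset.sum_eq_single (q a, q b)]
        · have hb : b ∈ compBQ r hrefl htrans (q a).out (q b).out :=
            (mem_compBQ_congr hrefl htrans _ _ (hout b)).1 (right_mem_compBQ hrefl htrans _ _)
          have ha : a ∉ compBQ r hrefl htrans (q a).out (q b).out := fun h =>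
            left_notMem_compBQ hrefl htrans htree hab'
              ((mem_compBQ_congr hrefl htrans _ _ (hout a)).2 h)
          have e1 : v (q a, q b) b = 1 := Set.indicator_of_mem hb _
          have e2 : v (q a, q b) a = 0 := Set.indicator_of_notMem ha _
          rw [e1, e2]
          simp only [t]
          rw [hxe _ _ (hout a), hxe _ _ (hout b)]
          ring
        · intro p hp hne
          have : v p a = v p b := by
            refine indVec_congr (mem_compBQ_cover hrefl htrans (hs p hp) hab ?_)
            rintro ⟨h1, h2⟩
            apply hne
            have e1 := (qmk_eq_iff hrefl htrans _ _).2 h1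
            have e2 := (qmk_eq_iff hrefl htrans _ _).2 h2
            rw [Quotient.out_eq] at e1 e2
            exact Prod.ext e1.symm e2.symm
          rw [this, sub_self]
        · intro h
          exact absurd (show (q a, q b) ∈ s from
            Finset.mem_filter.2 ⟨Finset.mem_univ (q a, q b), hab'⟩) h
      linarith
    have hconst : ∀ C D : Q, (hasseGraphQ r hrefl htrans).Reachable C D →
        ∀ a b, q a = C → q b = D → x a - y a = x b - y b := by
      have hcl : ∀ a b, q a = q b → x a - y a = x b - y b := by
        intro a b h
        have h' := (qmk_eq_iff hrefl htrans _ _).1 h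
        rw [hxe _ _ h', hye _ _ h']
      rintro C D ⟨w⟩
      induction w with
      | nil => intro a b ha hb; exact hcl a b (ha.trans hb.symm)
      | cons hadj _ ih =>
        intro a b ha hb
        obtain ⟨i, j, hi, hj, h⟩ := hadj
        rw [hcl a i (ha.trans hi.symm), ← ih j b hj hb]
        rcases h with h | h
        · exact hyc i j h
        · exact (hyc j i h).symm
    refine ⟨y, hy, x ⟨0, hn⟩ - y ⟨0, hn⟩, ?_⟩
    funext a
    have := hconst _ _ (htree.connected.preconnected (q a) (q ⟨0, hn⟩)) a ⟨0, hn⟩ rfl rfl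
    simp only [Pi.add_apply, Pi.smul_apply, allOnes, smul_eq_mul, mul_one]
    linarith
  · rintro ⟨y, ⟨s, c, hs, hc, rfl⟩, μ, rfl⟩ a b hab
    simp only [Pi.add_apply, Finset.sum_apply, Pi.smul_apply, smul_eq_mul, allOnes]
    have : ∑ v ∈ s, c v * v a ≤ ∑ v ∈ s, c v * v b := by
      refine Finset.sum_le_sum fun v hv => mul_le_mul_of_nonneg_left ?_ (hc v hv)
      obtain ⟨i, j, hij, rfl⟩ := hs hv
      exact indVec_compBQ_mem_sigmaCone hrefl htrans hij a b hab
    linarith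
end

section
/- Let n ≥ 1, let ⪯ be a tree poset on Fin n, let b ∈ Fin n have down-degree k ≥ 2, with a_1, …, a_k exactly the elements covered by b. Let E' be the set of pairs consisting of: all covering pairs (i,j) of ⪯ with j ≠ b, the pair (a_1, b), and the pairs (a_i, a_1) for 2 ≤ i ≤ k; and let ⪯' be the reflexive-transitive closure of E'. Then ⪯' is a partial order on Fin n, its covering relations are exactly the pairs in E', and its Hasse diagram is a tree; that is, ⪯' is a tree poset whose Hasse diagram has edge set E'. -/
section aux
variable {n : ℕ}

/-- Undirected graph of an asymmetric relation. -/
def symGraph (E : Fin n → Fin n → Prop) (has : ∀ i j, E i j → ¬ E j i) : SimpleGraph (Fin n) where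
  Adj a b := E a b ∨ E b a
  symm := ⟨fun a b h => h.symm⟩
  loopless := ⟨fun a h => by rcases h with h | h <;> exact has _ _ h h⟩

/-- For an edge `u → v`, a set containing `v` but not `u`, all other edges stay on one side. -/
theorem exists_cut (E : Fin n → Fin n → Prop) (has : ∀ i j, E i j → ¬ E j i)
    (hac : (symGraph E has).IsAcyclic) (u v : Fin n) (huv : E u v) :
    ∃ S : Set (Fin n), u ∉ S ∧ v ∈ S ∧
      ∀ x y, E x y → (x = u ∧ y = v) ∨ (x ∈ S ↔ y ∈ S) := by
  have hb := SimpleGraph.isAcyclic_iff_forall_adj_isBridge.1 hac (v := u) (w := v) (Or.inl huv)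
  rw [SimpleGraph.isBridge_iff] at hb
  refine ⟨{x | ((symGraph E has) \ SimpleGraph.fromEdgeSet {s(u, v)}).Reachable v x},
    fun h => hb h.symm, SimpleGraph.Reachable.refl _, ?_⟩
  intro x y hxy
  by_cases h : x = u ∧ y = v
  · exact Or.inl h
  · right
    have hadj : ((symGraph E has) \ SimpleGraph.fromEdgeSet {s(u, v)}).Adj x y := by
      rw [SimpleGraph.sdiff_adj]
      refine ⟨Or.inl hxy, ?_⟩
      rw [SimpleGraph.fromEdgeSet_adj]
      rintro ⟨h1, -⟩
      simp only [Set.mem_singleton_iff, Sym2.eq_iff] at h1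
      rcases h1 with h1 | ⟨rfl, rfl⟩
      · exact h h1
      · exact has _ _ huv hxy
    exact ⟨fun h => h.trans hadj.reachable, fun h => h.trans hadj.symm.reachable⟩

theorem closure_antisymm (E : Fin n → Fin n → Prop) (has : ∀ i j, E i j → ¬ E j i)
    (hac : (symGraph E has).IsAcyclic) (i j : Fin n)
    (h1 : Relation.ReflTransGen E i j) (h2 : Relation.ReflTransGen E j i) : i = j := by
  rcases Relation.ReflTransGen.cases_head h1 with h | ⟨u, hu, huj⟩
  · exact h
  · exfalso
    obtain ⟨S, h3, h4, h5⟩ := exists_cut E has hac i u hu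
    have h6 := huj.trans h2
    have : ∀ z, Relation.ReflTransGen E u z → z ∈ S := by
      intro z hz
      induction hz with
      | refl => exact h4
      | tail _ hbc ih =>
        rcases h5 _ _ hbc with ⟨_, rfl⟩ | h
        · exact h4
        · exact h.1 ih
    exact h3 (this _ h6)

theorem closure_covers (E : Fin n → Fin n → Prop) (has : ∀ i j, E i j → ¬ E j i)
    (hac : (symGraph E has).IsAcyclic) (i j : Fin n) :
    CoversRel (Relation.ReflTransGen E) i j ↔ E i j := by
  constructor
  · rintro ⟨h1, h2, h3⟩
    rcases Relation.ReflTransGen.cases_head h1 with h | ⟨u, hu, huj⟩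
    · exact absurd h h2
    · rcases h3 u (.single hu) huj with rfl | rfl
      · exact absurd hu (has _ _ hu)
      · exact hu
  · intro h
    refine ⟨.single h, fun e => by subst e; exact has _ _ h h, ?_⟩
    intro c hic hcj
    obtain ⟨S, h3, h4, h5⟩ := exists_cut E has hac i j h
    have key : ∀ x y, Relation.ReflTransGen E x y → x ∉ S → y ∈ S →
        Relation.ReflTransGen E x i ∧ Relation.ReflTransGen E j y := by
      intro x y hxy hx
      induction hxy with
      | refl => exact fun h => absurd h hx
      | tail hab hbc ih =>
        intro hc
        rcases h5 _ _ hbc with ⟨rfl, rfl⟩ | h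
        · exact ⟨hab, .refl⟩
        · have := ih (h.2 hc)
          exact ⟨this.1, this.2.tail hbc⟩
    by_cases hc : c ∈ S
    · right
      exact closure_antisymm E has hac _ _ hcj (key _ _ hic h3 hc).2
    · left
      exact closure_antisymm E has hac _ _ (key _ _ hcj hc h4).1 hic

theorem newRel_asymm (r : Fin n → Fin n → Prop)
    (has : ∀ a b, r a b → r b a → a = b)
    (b : Fin n) (k : ℕ) (a : Fin k → Fin n) (hainj : Function.Injective a)
    (hcov : ∀ i, CoversRel r (a i) b) (i₀ : Fin k) (i j : Fin n)
    (h1 : newRel r a b i₀ i j) : ¬ newRel r a b i₀ j i := by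
  have hne : ∀ m, a m ≠ b := fun m => (hcov m).2.1
  have hcc : ∀ m, ¬ CoversRel r (a i₀) (a m) := by
    intro m h
    rcases (hcov i₀).2.2 (a m) h.1 (hcov m).1 with h' | h'
    · exact h.2.1 h'.symm
    · exact hne m h'
  intro h2
  rcases h1 with ⟨h1, h1'⟩ | ⟨rfl, rfl⟩ | ⟨m, hm, rfl, rfl⟩ <;>
  rcases h2 with ⟨h2, h2'⟩ | ⟨h2, h2'⟩ | ⟨m', hm', h2, h2'⟩
  · exact h1.2.1 (has _ _ h1.1 h2.1)
  · subst h2 h2'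
    exact hne _ (has _ _ (hcov i₀).1 h1.1)
  · subst h2 h2'
    exact hcc _ h1
  · exact hne _ (has _ _ (hcov i₀).1 h2.1)
  · exact hne _ h2'
  · exact hne _ h2.symm
  · exact hcc _ h2
  · exact hne _ h2'
  · exact hm (hainj h2')

theorem newRel_tree (r : Fin n → Fin n → Prop) (hposet : IsTreePoset r)
    (b : Fin n) (k : ℕ) (a : Fin k → Fin n) (hainj : Function.Injective a)
    (hcov : ∀ x, CoversRel r x b ↔ ∃ i, a i = x) (i₀ : Fin k)
    (has : ∀ i j, newRel r a b i₀ i j → ¬ newRel r a b i₀ j i) :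
    (symGraph (newRel r a b i₀) has).IsTree := by
  classical
  obtain ⟨-, -, hanti, htree⟩ := hposet
  have hcov' : ∀ i, CoversRel r (a i) b := fun i => (hcov _).2 ⟨i, rfl⟩
  have hne : ∀ m, a m ≠ b := fun m => (hcov' m).2.1
  set G := symGraph (newRel r a b i₀) has with hG
  have hb : ∀ m, G.Reachable (a m) b := by
    intro m
    have h0 : G.Adj (a i₀) b := Or.inl (Or.inr (Or.inl ⟨rfl, rfl⟩))
    by_cases hm : m = i₀
    · subst hm; exact h0.reachable
    · have h1 : G.Adj (a m) (a i₀) := Or.inl (Or.inr (Or.inr ⟨m, hm, rfl, rfl⟩))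
      exact h1.reachable.trans h0.reachable
  have hc : ∀ x y, CoversRel r x y → G.Reachable x y := by
    intro x y h
    by_cases hy : y = b
    · subst hy
      obtain ⟨m, rfl⟩ := (hcov _).1 h
      exact hb m
    · exact SimpleGraph.Adj.reachable (Or.inl (Or.inl ⟨h, hy⟩))
  have hconn : G.Connected := by
    have := htree.1.nonempty
    refine SimpleGraph.Connected.mk fun x y => ?_
    obtain ⟨p⟩ := htree.1.preconnected x y
    induction p with
    | nil => exact SimpleGraph.Reachable.refl _
    | cons h _ ih =>
      refine SimpleGraph.Reachable.trans ?_ ih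
      rcases h with h | h
      · exact hc _ _ h
      · exact (hc _ _ h).symm
  rw [SimpleGraph.isTree_iff_connected_and_card]
  refine ⟨hconn, le_antisymm ?_ hconn.card_vert_le_card_edgeSet_add_one⟩
  rw [← (SimpleGraph.isTree_iff_connected_and_card.1 htree).2]
  let φ : Sym2 (Fin n) → Sym2 (Fin n) := fun e =>
    if h : ∃ m, m ≠ i₀ ∧ e = s(a m, b) then s(a h.choose, a i₀) else e
  have hsub : G.edgeSet ⊆ φ '' (hasseGraph r).edgeSet := by
    have main : ∀ x y, newRel r a b i₀ x y → s(x, y) ∈ φ '' (hasseGraph r).edgeSet := by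
      rintro x y (⟨h, hy⟩ | ⟨rfl, rfl⟩ | ⟨m, hm, rfl, rfl⟩)
      · refine ⟨s(x, y), Or.inl h, dif_neg ?_⟩
        rintro ⟨m, hm, he⟩
        rcases Sym2.eq_iff.1 he with ⟨-, h2⟩ | ⟨rfl, rfl⟩
        · exact hy h2
        · exact hne m (hanti _ _ (hcov' m).1 h.1)
      · refine ⟨s(a i₀, y), Or.inl (hcov' _), dif_neg ?_⟩
        rintro ⟨m, hm, he⟩
        rcases Sym2.eq_iff.1 he with ⟨h1, -⟩ | ⟨h1, -⟩
        · exact hm (hainj h1).symm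
        · exact hne _ h1
      · refine ⟨s(a m, b), Or.inl (hcov' _), ?_⟩
        have h : ∃ m', m' ≠ i₀ ∧ s(a m, b) = s(a m', b) := ⟨m, hm, rfl⟩
        have e : φ s(a m, b) = s(a h.choose, a i₀) := dif_pos h
        rw [e]
        rcases Sym2.eq_iff.1 h.choose_spec.2 with ⟨h1, -⟩ | ⟨h1, -⟩
        · rw [← h1]
        · exact absurd h1 (hne _)
    intro e
    induction e using Sym2.ind with
    | _ x y =>
      rintro (h | h)
      · exact main _ _ h
      · rw [Sym2.eq_swap]; exact main _ _ h
  have h1 := Set.ncard_le_ncard hsub (Set.toFinite _)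
  have h2 := Set.ncard_image_le (f := φ) (Set.toFinite (hasseGraph r).edgeSet)
  exact Nat.add_le_add_right (h1.trans h2) 1

end aux

/-- Let `⪯` be a tree poset on `Fin n`, `b` an element of down-degree
`k ≥ 2` with `a 0, …, a (k-1)` exactly the elements covered by `b`, and let `⪯'` be the
reflexive-transitive closure of `E' = {covering pairs (i,j) of ⪯ with j ≠ b} ∪
{(a i₀, b)} ∪ {(a m, a i₀) : m ≠ i₀}`. Then `⪯'` is a partial order, its covering
relations are exactly the pairs of `E'`, and its Hasse diagram is a tree. -/
theorem newRel_closure_is_treePoset (n : ℕ) (hn : 1 ≤ n)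
    (r : Fin n → Fin n → Prop) (hposet : IsTreePoset r)
    (b : Fin n) (k : ℕ) (hk : 2 ≤ k)
    (a : Fin k → Fin n) (hainj : Function.Injective a)
    (hcov : ∀ x, CoversRel r x b ↔ ∃ i, a i = x) (i₀ : Fin k) :
    (∀ i, Relation.ReflTransGen (newRel r a b i₀) i i) ∧
    (∀ i j l, Relation.ReflTransGen (newRel r a b i₀) i j →
      Relation.ReflTransGen (newRel r a b i₀) j l →
      Relation.ReflTransGen (newRel r a b i₀) i l) ∧
    (∀ i j, Relation.ReflTransGen (newRel r a b i₀) i j →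
      Relation.ReflTransGen (newRel r a b i₀) j i → i = j) ∧
    (∀ i j, CoversRel (Relation.ReflTransGen (newRel r a b i₀)) i j ↔ newRel r a b i₀ i j) ∧
    (hasseGraph (Relation.ReflTransGen (newRel r a b i₀))).IsTree := by
  have has := newRel_asymm r hposet.2.2.1 b k a hainj (fun i => (hcov _).2 ⟨i, rfl⟩) i₀
  have ht := newRel_tree r hposet b k a hainj hcov i₀ has
  have hcv := closure_covers _ has ht.IsAcyclic
  refine ⟨fun _ => .refl, fun _ _ _ h1 h2 => h1.trans h2,
    closure_antisymm _ has ht.IsAcyclic, hcv, ?_⟩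
  have : hasseGraph (Relation.ReflTransGen (newRel r a b i₀)) = symGraph _ has := by
    ext x y
    exact or_congr (hcv x y) (hcv y x)
  rw [this]
  exact ht
end
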